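/- Let $A$ be a finite-dimensional associative unital $K$-algebra whose group of units $E(A)$ is a nilpotent group. Then $A$ is soluble, i.e. $A/\mathrm{rad}(A)$ is commutative. -/

import Mathlib

open scoped TensorProduct

universe u

/-- The Jacobson radical of the ring `A`, i.e. the intersection of all maximal left ideals of
`A`; for a finite-dimensional algebra it coincides with the nilradical. -/
def jacobsonRadical (A : Type u) [Ring A] : Ideal A :=
  Ideal.jacobson ⊥

/-- `A` is a *soluble* algebra if `A / rad A` is commutative, i.e. every commutator of `A` lies
in the Jacobson radical of `A`. -/
def IsSolubleAlgebra (A : Type u) [Ring A] : Prop :=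
  ∀ a b : A, a * b - b * a ∈ jacobsonRadical A

open scoped commutatorElement in
/-- In a nilpotent group, an element `w` with `⁅s, w⁆ = w` for some `s` is trivial. -/
theorem Group.IsNilpotent.eq_one_of_commutatorElement_eq_self {G : Type*} [Group G]
    [Group.IsNilpotent G] {w s : G} (h : ⁅s, w⁆ = w) : w = 1 := by
  obtain ⟨n, hn⟩ := Group.IsNilpotent.nilpotent G
  have descend : ∀ m, w ∈ Subgroup.upperCentralSeries G m → w = 1 := by
    intro m
    induction m with
    | zero => simp
    | succ m ih =>
      intro hw
      have := inv_mem (Subgroup.mem_upperCentralSeries_succ_iff.mp hw s)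
      rw [commutatorElement_inv, h] at this
      exact ih this
  exact descend n (hn ▸ Subgroup.mem_top w)

/-- If `x` and `y` generate a system of `2 × 2` matrix units in a ring whose unit group is
nilpotent, then this system is trivial. -/
theorem eq_zero_of_isNilpotent_units {R : Type*} [Ring R] [Group.IsNilpotent Rˣ] {x y : R}
    (hx : x * x = 0) (hy : y * y = 0) (hxyx : x * y * x = x) (hyxy : y * x * y = y) : x = 0 := by
  have hx' (a : R) : x * (x * a) = 0 := by rw [← mul_assoc, hx, zero_mul]
  have hy' (a : R) : y * (y * a) = 0 := by rw [← mul_assoc, hy, zero_mul]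
  have hxyx' : x * (y * x) = x := by rw [← mul_assoc, hxyx]
  have hyxy' : y * (x * y) = y := by rw [← mul_assoc, hyxy]
  let w : R := 1 - x * y - y * x - y * x - x + y
  let v : R := 1 - x * y - x * y - y * x + x - y
  let s : R := 1 - x * y - y * x + x + y
  have hwv : w * v = 1 := by
    simp only [w, v, mul_add, add_mul, mul_sub, sub_mul, mul_assoc, hx, hy, hx', hy', hxyx',
      hyxy', mul_one, one_mul, mul_zero]
    abel
  have hvw : v * w = 1 := by
    simp only [w, v, mul_add, add_mul, mul_sub, sub_mul, mul_assoc, hx, hy, hx', hy', hxyx',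
      hyxy', mul_one, one_mul, mul_zero]
    abel
  have hss : s * s = 1 := by
    simp only [s, mul_add, add_mul, mul_sub, sub_mul, mul_assoc, hx, hy, hx', hy', hxyx',
      hyxy', mul_one, one_mul, mul_zero]
    abel
  have hcomm : s * w * s * v = w := by
    simp only [s, w, v, mul_add, add_mul, mul_sub, sub_mul, mul_assoc, hx, hy, hx', hy', hxyx',
      hyxy', mul_one, one_mul, mul_zero]
    abel
  let S : Rˣ := ⟨s, s, hss, hss⟩
  let W : Rˣ := ⟨w, v, hwv, hvw⟩
  have hW : W = 1 := Group.IsNilpotent.eq_one_of_commutatorElement_eq_self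
    (s := S) (Units.ext hcomm)
  have hw : w = 1 := congrArg Units.val hW
  have : x * w * x = x := by
    simp only [w, mul_add, add_mul, mul_sub, sub_mul, mul_assoc, hx, hx', hxyx', mul_one,
      zero_mul]
    abel
  rwa [hw, mul_one, hx, eq_comm] at this

open scoped commutatorElement in
/-- In a division ring, an element whose commutators with all nonzero elements are central is
itself central: the second center of the unit group equals the center. -/
theorem DivisionRing.mem_center_units_of_commutatorElement_mem_center {D : Type*}
    [DivisionRing D] {x : Dˣ} (h : ∀ y : Dˣ, ⁅x, y⁆ ∈ Subgroup.center Dˣ) :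
    x ∈ Subgroup.center Dˣ := by
  rw [Subgroup.mem_center_iff]
  intro y
  by_contra hyx
  have hyx' : (y : D) * x ≠ x * y := fun e ↦ hyx (Units.ext e)
  have hy1 : (1 + y : D) ≠ 0 := by
    intro e
    rw [add_eq_zero_iff_neg_eq] at e
    exact hyx' (by simp [← e])
  let z : Dˣ := Units.mk0 (1 + y : D) hy1
  have key (u : Dˣ) : (x : D) * u = (⁅x, u⁆ : Dˣ) * (u * x) := by
    have : x * u = ⁅x, u⁆ * (u * x) := by simp [commutatorElement_def, mul_assoc]
    simpa using congrArg Units.val this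
  obtain ⟨c, hc⟩ : ∃ c, c = ⁅x, y⁆ := ⟨_, rfl⟩
  obtain ⟨d, hd⟩ : ∃ d, d = ⁅x, z⁆ := ⟨_, rfl⟩
  have hcx : (x : D) * c = c * x :=
    congrArg Units.val (Subgroup.mem_center_iff.mp (hc ▸ h y) x)
  have hdx : (x : D) * d = d * x :=
    congrArg Units.val (Subgroup.mem_center_iff.mp (hd ▸ h z) x)
  have h₁ := key y
  have h₂ := key z
  rw [← hc] at h₁
  rw [← hd] at h₂
  simp only [z, Units.val_mk0] at h₂
  have h₃ : ((d : D) - c) * y = 1 - d := by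
    apply mul_right_cancel₀ x.ne_zero
    rw [mul_add, h₁, mul_one, add_mul, mul_add, one_mul] at h₂
    rw [sub_mul, sub_mul, sub_mul, one_mul, mul_assoc, mul_assoc, sub_eq_sub_iff_add_eq_add, h₂]
    abel
  by_cases hdc : (d : D) = c
  · rw [hdc, sub_self, zero_mul, eq_comm, sub_eq_zero] at h₃
    rw [← h₃, one_mul] at h₁
    exact hyx' h₁.symm
  · have hcomm₁ : Commute (x : D) (d - c) := Commute.sub_right hdx hcx
    have hcomm₂ : Commute (x : D) (1 - d) := (Commute.one_right _).sub_right hdx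
    have hy : (y : D) = (d - c : D)⁻¹ * (1 - d) := by
      rw [← h₃, inv_mul_cancel_left₀ (sub_ne_zero.mpr hdc)]
    have : Commute (x : D) y := hy ▸ hcomm₁.inv_right₀.mul_right hcomm₂
    exact hyx' this.eq.symm

/-- A division ring with nilpotent unit group is commutative. -/
theorem DivisionRing.mul_comm_of_isNilpotent_units {D : Type*} [DivisionRing D]
    [Group.IsNilpotent Dˣ] (a b : D) : a * b = b * a := by
  obtain ⟨n, hn⟩ := Group.IsNilpotent.nilpotent Dˣ
  have hle : ∀ m, Subgroup.upperCentralSeries Dˣ m ≤ Subgroup.center Dˣ := by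
    intro m
    induction m with
    | zero => simp
    | succ m ih =>
      exact fun x hx ↦ mem_center_units_of_commutatorElement_mem_center fun y ↦
        ih (Subgroup.mem_upperCentralSeries_succ_iff.mp hx y)
  rcases eq_or_ne a 0 with rfl | ha
  · simp
  rcases eq_or_ne b 0 with rfl | hb
  · simp
  have hmem : Units.mk0 b hb ∈ Subgroup.center Dˣ := hle n (hn ▸ Subgroup.mem_top _)
  exact congrArg Units.val (Subgroup.mem_center_iff.mp hmem (Units.mk0 a ha))

/-- If every unit of `S` is the image of a unit of `R` under a monoid homomorphism and `Rˣ` is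
nilpotent, then so is `Sˣ`. -/
theorem isNilpotent_units_of_forall_exists_isUnit {R S : Type*} [Monoid R] [Monoid S]
    [Group.IsNilpotent Rˣ] (f : R →* S) (hf : ∀ s : Sˣ, ∃ r : R, IsUnit r ∧ f r = s) :
    Group.IsNilpotent Sˣ := by
  refine Group.nilpotent_of_surjective (Units.map f) fun s ↦ ?_
  obtain ⟨r, ⟨u, rfl⟩, hr⟩ := hf s
  exact ⟨u, Units.ext hr⟩

/-- A matrix ring over a division ring with nilpotent unit group is commutative. -/
theorem Matrix.mul_comm_of_isNilpotent_units {n D : Type*} [Fintype n] [DecidableEq n]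
    [DivisionRing D] [Group.IsNilpotent (Matrix n n D)ˣ] (a b : Matrix n n D) :
    a * b = b * a := by
  by_cases hn : Subsingleton n
  · rcases isEmpty_or_nonempty n with _ | ⟨⟨i⟩⟩
    · exact Subsingleton.elim _ _
    have := uniqueOfSubsingleton i
    obtain rfl : ‹Fintype n› = Unique.fintype := Subsingleton.elim _ _
    let e : Matrix n n D ≃+* D := Matrix.uniqueRingEquiv
    have : Group.IsNilpotent Dˣ := (Group.isNilpotent_congr (Units.mapEquiv e.toMulEquiv)).mp ‹_›
    apply e.injective
    rw [map_mul, map_mul, DivisionRing.mul_comm_of_isNilpotent_units]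
  · rw [not_subsingleton_iff_nontrivial] at hn
    obtain ⟨i, j, hij⟩ := exists_pair_ne n
    have hzero := eq_zero_of_isNilpotent_units (x := Matrix.single i j (1 : D))
      (y := Matrix.single j i (1 : D)) (by simp [hij.symm]) (by simp [hij])
      (by simp) (by simp)
    simpa using congrFun (congrFun hzero i) j

/-- A semisimple ring with nilpotent unit group is commutative. -/
theorem IsSemisimpleRing.mul_comm_of_isNilpotent_units {R : Type*} [Ring R] [IsSemisimpleRing R]
    [Group.IsNilpotent Rˣ] (a b : R) : a * b = b * a := by
  obtain ⟨n, D, d, _, _, ⟨e⟩⟩ := IsSemisimpleRing.exists_ringEquiv_pi_matrix_divisionRing R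
  apply e.injective
  rw [map_mul, map_mul]
  funext i
  let M := fun i ↦ Matrix (Fin (d i)) (Fin (d i)) (D i)
  have : Group.IsNilpotent (M i)ˣ := by
    refine isNilpotent_units_of_forall_exists_isUnit
      ((Pi.evalMonoidHom M i).comp e.toMulEquiv.toMonoidHom) fun s ↦ ?_
    let t : (∀ i, M i)ˣ := MulEquiv.piUnits.symm (Pi.mulSingle i s)
    exact ⟨e.symm t, t.isUnit.map e.symm, by simp [t]⟩
  exact Matrix.mul_comm_of_isNilpotent_units _ _

/-- An element congruent to `1` modulo the Jacobson radical is a unit, in a ring that need not be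
commutative. -/
theorem Ring.isUnit_of_sub_one_mem_jacobson {R : Type*} [Ring R] {r : R}
    (h : r - 1 ∈ Ring.jacobson R) : IsUnit r := by
  have left_inv (u : R) (hu : u - 1 ∈ Ring.jacobson R) : ∃ v, v * u = 1 := by
    rw [← Ideal.jacobson_bot] at hu
    obtain ⟨v, hv⟩ := Ideal.exists_mul_sub_mem_of_sub_one_mem_jacobson u hu
    exact ⟨v, sub_eq_zero.mp (Ideal.mem_bot.mp hv)⟩
  obtain ⟨v, hv⟩ := left_inv r h
  have hv1 : v - 1 ∈ Ring.jacobson R := by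
    have := (Ring.jacobson R).neg_mem ((Ring.jacobson R).mul_mem_left v h)
    rwa [mul_sub, hv, mul_one, neg_sub] at this
  obtain ⟨w, hw⟩ := left_inv v hv1
  have hwr : w = r := left_inv_eq_right_inv hw hv
  exact ⟨⟨r, v, hwr ▸ hw, hv⟩, rfl⟩

/-- An element that is a unit modulo the Jacobson radical is a unit. -/
theorem Ring.isUnit_of_isUnit_mk_jacobson {R : Type*} [Ring R] {r : R}
    (h : IsUnit (Ideal.Quotient.mk (Ring.jacobson R) r)) : IsUnit r := by
  obtain ⟨u, hu⟩ := h
  obtain ⟨v, hv⟩ := Ideal.Quotient.mk_surjective (I := Ring.jacobson R) (↑u⁻¹)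
  have hrv : IsUnit (r * v) := isUnit_of_sub_one_mem_jacobson <| by
    rw [← Ideal.Quotient.mk_eq_mk_iff_sub_mem, map_mul, ← hu, hv, map_one, Units.mul_inv]
  have hvr : IsUnit (v * r) := isUnit_of_sub_one_mem_jacobson <| by
    rw [← Ideal.Quotient.mk_eq_mk_iff_sub_mem, map_mul, ← hu, hv, map_one, Units.inv_mul]
  obtain ⟨a, ha⟩ := hrv.exists_right_inv
  obtain ⟨b, hb⟩ := hvr.exists_left_inv
  rw [mul_assoc] at ha
  rw [← mul_assoc] at hb
  have hba : b * v = v * a := left_inv_eq_right_inv hb ha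
  exact ⟨⟨r, v * a, ha, hba ▸ hb⟩, rfl⟩


/-- Every finite-dimensional associative unital `K`-algebra whose group of units `E(A) = Aˣ`
is a nilpotent group is soluble, i.e. `A / rad A` is commutative. -/
theorem soluble_of_nilpotent_unitGroup
    (K A : Type u) [Field K] [Ring A] [Algebra K A] [FiniteDimensional K A]
    (h : Group.IsNilpotent Aˣ) :
    IsSolubleAlgebra A := by
  intro a b
  have : IsArtinianRing A := IsArtinianRing.of_finite K A
  have : Group.IsNilpotent (A ⧸ Ring.jacobson A)ˣ := by
    refine isNilpotent_units_of_forall_exists_isUnit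
      (Ideal.Quotient.mk (Ring.jacobson A)).toMonoidHom fun s ↦ ?_
    obtain ⟨r, hr⟩ := Ideal.Quotient.mk_surjective (I := Ring.jacobson A) (s : A ⧸ Ring.jacobson A)
    exact ⟨r, Ring.isUnit_of_isUnit_mk_jacobson (hr ▸ s.isUnit), hr⟩
  rw [jacobsonRadical, Ideal.jacobson_bot, ← Ideal.Quotient.mk_eq_mk_iff_sub_mem, map_mul, map_mul]
  exact IsSemisimpleRing.mul_comm_of_isNilpotent_units _ _
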